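/- Weak-* convergence in L²_w does not imply a.e. weak-* convergence within sublevel sets of the regularizer: with Ω = I = [0,1], for i ≥ 1 and j ∈ {0,…,2^{i−1}−1} set k = 2^{i−1}+j, Ω_k = I_k = 2^{1−i}[j, j+1) (closed at the right endpoint when j = 2^{i−1}−1), and define μ^k_t = 2^{i−1} ℒ ⌞ Ω_k for t ∈ I_k and μ^k_t = δ₀ otherwise. Then: (i) each μ^k ∈ 𝒜 with ω(μ^k) = 1 and essvar(μ^k) ≤ 2, so μ^k ∈ L₃^−(𝓡_{1,1}); (ii) μ^k ⇀* μ in L²_w(I;ℳ(Ω)) as k → ∞, where μ_t ≡ δ₀; (iii) nevertheless there exists ψ ∈ C(Ω) (e.g. ψ(x) = min(2x,1)) such that ⟨ψ, μ^k_t⟩ does not converge to ⟨ψ, μ_t⟩ = ψ(0) for a.e. t ∈ I along the full sequence. -/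

import Mathlib

open MeasureTheory Filter Topology Set
open scoped ENNReal NNReal

noncomputable section

/-- The unit time interval `[0,1] ⊆ ℝ`. -/
def unitI : Set ℝ := Set.Icc 0 1

/-- Lebesgue measure restricted to the unit interval. -/
def lebI : Measure ℝ := volume.restrict unitI

/-- The (pointwise) variation of a curve `f : ℝ → X` on a set `s ⊆ ℝ`,
with respect to a distance function `d`. -/
def varOn {X : Type*} (d : X → X → ℝ≥0∞) (f : ℝ → X) (s : Set ℝ) : ℝ≥0∞ :=
  ⨆ p : ℕ × { u : ℕ → ℝ // Monotone u ∧ ∀ i, u i ∈ s },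
    ∑ i ∈ Finset.range p.1, d (f (p.2.1 (i + 1))) (f (p.2.1 i))

/-- The essential variation of `f` on `s`: infimum of variations over a.e. representatives. -/
def essVarOn {X : Type*} (d : X → X → ℝ≥0∞) (f : ℝ → X) (s : Set ℝ) : ℝ≥0∞ :=
  ⨅ g ∈ {g : ℝ → X | ∀ᵐ t ∂(volume.restrict s), g t = f t}, varOn d g s

/-- Essential variation on the unit interval. -/
def essVar {X : Type*} (d : X → X → ℝ≥0∞) (f : ℝ → X) : ℝ≥0∞ := essVarOn d f unitI

/-- Couplings (transport plans) between two measures. -/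
def IsCoupling {X : Type*} [MeasurableSpace X] (ρp ρm : Measure X)
    (π : Measure (X × X)) : Prop :=
  π.map Prod.fst = ρp ∧ π.map Prod.snd = ρm

/-- The Wasserstein-1 distance between measures. -/
def W1 {X : Type*} [MeasurableSpace X] [PseudoEMetricSpace X]
    (ρp ρm : Measure X) : ℝ≥0∞ :=
  ⨅ π ∈ {π : Measure (X × X) | IsCoupling ρp ρm π}, ∫⁻ q, edist q.1 q.2 ∂π

/-- `W1` as a distance function on measures. -/
def W1M {X : Type*} [MeasurableSpace X] [PseudoEMetricSpace X] :
    Measure X → Measure X → ℝ≥0∞ := fun a b => W1 a b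

/-- Wasserstein-1 distance on probability measures. -/
def W1P {X : Type*} [MeasurableSpace X] [PseudoEMetricSpace X] :
    ProbabilityMeasure X → ProbabilityMeasure X → ℝ≥0∞ :=
  fun a b => W1 (a : Measure X) (b : Measure X)

/-- The spatial domain `Ω = [0,1] ⊆ ℝ`. -/
def ΩI : Set ℝ := Set.Icc 0 1

/-- The admissible set `𝒜 = ℝ₊ ⬝ BV(I; 𝒲₁(Ω))` for `Ω = [0,1] ⊆ ℝ`. -/
def AdmR : Set (ℝ → Measure ↥ΩI) :=
  {μ | ∃ (c : ℝ≥0) (ρ : ℝ → ProbabilityMeasure ↥ΩI),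
      essVar W1P ρ < ⊤ ∧ ∀ t, μ t = (c : ℝ≥0∞) • (ρ t : Measure ↥ΩI)}

/-- The weight `ω(μ)` of an admissible curve. -/
def wtR (μ : ℝ → Measure ↥ΩI) : ℝ := (μ 0 Set.univ).toReal

/-- The regularizer `𝓡_{1,1}(μ) = ω(μ) + essvar(μ)`. -/
def RegR (μ : ℝ → Measure ↥ΩI) : ℝ := wtR μ + (essVar W1M μ).toReal

/-- The sup-norm of a continuous function on `Ω`. -/
def supNorm (φ : C(↥ΩI, ℝ)) : ℝ := ⨆ x : ↥ΩI, |φ x|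

/-- Membership in `L²_w(I;C(Ω))`: (weak) measurability and square-integrable sup-norm. -/
def L2wTest (φ : ℝ → C(↥ΩI, ℝ)) : Prop :=
  (∀ x : ↥ΩI, AEMeasurable (fun t => φ t x) lebI) ∧
  ∫⁻ t in unitI, ENNReal.ofReal (supNorm (φ t)) ^ 2 < ⊤

/-- Weak-* convergence in `L²_w(I;ℳ(Ω))`, tested against `L²_w(I;C(Ω))`. -/
def WStarL2Tendsto (μs : ℕ → (ℝ → Measure ↥ΩI)) (μ : ℝ → Measure ↥ΩI) : Prop :=
  ∀ φ : ℝ → C(↥ΩI, ℝ), L2wTest φ →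
    Tendsto (fun j => ∫ t in unitI, ∫ x, (φ t) x ∂(μs j t)) atTop
      (𝓝 (∫ t in unitI, ∫ x, (φ t) x ∂(μ t)))

/-- The point `0 ∈ Ω`. -/
def z0 : ↥ΩI := ⟨0, Set.left_mem_Icc.mpr zero_le_one⟩

/-- For `k = 2^{i−1} + j` (`i ≥ 1`, `0 ≤ j < 2^{i−1}`), the index `j`. -/
def jOf (k : ℕ) : ℕ := k - 2 ^ Nat.log 2 k

/-- The mesh `2^{1−i} = (2^{i−1})⁻¹` associated with `k = 2^{i−1} + j`. -/
def wk (k : ℕ) : ℝ := ((2 : ℝ) ^ Nat.log 2 k)⁻¹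

/-- The spatial/time interval `Ω_k = I_k = 2^{1−i}[j, j+1)`
(closed at the right endpoint when `j = 2^{i−1} − 1`). -/
def ΩS (k : ℕ) : Set ℝ :=
  if jOf k = 2 ^ Nat.log 2 k - 1 then
    Set.Icc ((jOf k : ℝ) * wk k) (((jOf k : ℝ) + 1) * wk k)
  else
    Set.Ico ((jOf k : ℝ) * wk k) (((jOf k : ℝ) + 1) * wk k)

/-- Lebesgue measure on `Ω = [0,1]` as a measure on the subtype. -/
def lebSub : Measure ↥ΩI := Measure.comap Subtype.val volume

open scoped Classical in
/-- The BV curve `μ^k`: equal to `2^{i−1} ℒ ⌞ Ω_k` for `t ∈ I_k` and to `δ₀` otherwise. -/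
def muk (k : ℕ) : ℝ → Measure ↥ΩI :=
  fun t =>
    if t ∈ ΩS k then ENNReal.ofReal (wk k)⁻¹ • lebSub.restrict (Subtype.val ⁻¹' ΩS k)
    else Measure.dirac z0

/-- The product coupling bounds `W1` of probability measures on `[0,1]` by the diameter. -/
lemma W1_le_one (μ ν : Measure ↥ΩI) [IsProbabilityMeasure μ] [IsProbabilityMeasure ν] :
    W1 μ ν ≤ 1 := by
  refine (iInf₂_le (μ.prod ν) ⟨by simp, by simp⟩).trans ?_
  calc ∫⁻ q, edist q.1 q.2 ∂(μ.prod ν) ≤ ∫⁻ _, 1 ∂(μ.prod ν) := by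
        refine lintegral_mono fun q => ?_
        rw [Subtype.edist_eq, edist_dist]
        refine ENNReal.ofReal_le_one.2 ((Real.dist_le_of_mem_Icc_01 q.1.2 q.2.2))
    _ = 1 := by simp

lemma W1_self {X : Type*} [MeasurableSpace X] [PseudoEMetricSpace X] [OpensMeasurableSpace X]
    [SecondCountableTopology X] (μ : Measure X) : W1 μ μ = 0 := by
  have hm : Measurable fun x : X => (x, x) := measurable_id.prodMk measurable_id
  have hcpl : IsCoupling μ μ (μ.map fun x => (x, x)) := by
    constructor
    · rw [Measure.map_map measurable_fst hm]
      exact Measure.map_id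
    · rw [Measure.map_map measurable_snd hm]
      exact Measure.map_id
  refine le_antisymm ((iInf₂_le _ hcpl).trans ?_) bot_le
  rw [lintegral_map measurable_edist hm]
  simp

/-- A curve with one value on an order-connected set and another value off it jumps at most
twice. -/
lemma varOn_le_two {X : Type*} (d : X → X → ℝ≥0∞) {f : ℝ → X} {S : Set ℝ} (hS : S.OrdConnected)
    {a b : X} (hin : ∀ t ∈ S, f t = a) (hout : ∀ t ∉ S, f t = b)
    (haa : d a a = 0) (hbb : d b b = 0) (hab : d a b ≤ 1) (hba : d b a ≤ 1) (s : Set ℝ) :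
    varOn d f s ≤ 2 := by
  classical
  let lev : ℝ → ℝ≥0∞ := fun t => if t ∈ S then 1 else if ∃ r ∈ S, r ≤ t then 2 else 0
  have hlev : ∀ t, lev t ≤ 2 := by
    intro t
    simp only [lev]
    split_ifs <;> norm_num
  have hstep : ∀ t t', t ≤ t' → lev t + d (f t') (f t) ≤ lev t' := by
    intro t t' htt
    simp only [lev]
    by_cases ht : t ∈ S <;> by_cases ht' : t' ∈ S
    · simp [ht, ht', hin, haa]
    · have : ∃ r ∈ S, r ≤ t' := ⟨t, ht, htt⟩
      rw [hin t ht, hout t' ht', if_pos ht, if_neg ht', if_pos this, ← one_add_one_eq_two]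
      gcongr
    · have : ¬ ∃ r ∈ S, r ≤ t := fun ⟨r, hr, hrt⟩ => ht (hS.out hr ht' ⟨hrt, htt⟩)
      rw [hout t ht, hin t' ht', if_neg ht, if_pos ht', if_neg this, zero_add]
      exact hab
    · rw [hout t ht, hout t' ht', if_neg ht, if_neg ht', hbb, add_zero]
      by_cases h : ∃ r ∈ S, r ≤ t
      · have : ∃ r ∈ S, r ≤ t' := h.imp fun r hr => ⟨hr.1, hr.2.trans htt⟩
        rw [if_pos h, if_pos this]
      · simp [h]
  refine iSup_le ?_
  rintro ⟨n, u, hu, -⟩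
  have hsum : ∀ n, ∑ i ∈ Finset.range n, d (f (u (i + 1))) (f (u i)) ≤ lev (u n) := by
    intro n
    induction n with
    | zero => simp
    | succ n ih =>
      rw [Finset.sum_range_succ]
      exact (add_le_add_left ih _).trans (hstep _ _ (hu n.le_succ))
  exact (hsum n).trans (hlev _)

lemma essVar_le_varOn {X : Type*} (d : X → X → ℝ≥0∞) (f : ℝ → X) :
    essVar d f ≤ varOn d f unitI :=
  iInf₂_le f (ae_of_all _ fun _ => rfl)

lemma ordConnected_ΩS (k : ℕ) : (ΩS k).OrdConnected := by
  unfold ΩS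
  split_ifs
  · exact ordConnected_Icc
  · exact ordConnected_Ico

lemma measurableSet_ΩS (k : ℕ) : MeasurableSet (ΩS k) := (ordConnected_ΩS k).measurableSet

lemma wk_pos (k : ℕ) : 0 < wk k := by
  unfold wk
  positivity

lemma ΩS_subset_Icc (k : ℕ) :
    ΩS k ⊆ Icc ((jOf k : ℝ) * wk k) (((jOf k : ℝ) + 1) * wk k) := by
  unfold ΩS
  split_ifs
  · exact Subset.rfl
  · exact Ico_subset_Icc_self

lemma Ico_subset_ΩS (k : ℕ) :
    Ico ((jOf k : ℝ) * wk k) (((jOf k : ℝ) + 1) * wk k) ⊆ ΩS k := by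
  unfold ΩS
  split_ifs
  · exact Ico_subset_Icc_self
  · exact Subset.rfl

lemma ΩS_subset_ΩI {k : ℕ} (hk : 1 ≤ k) : ΩS k ⊆ ΩI := by
  refine (ΩS_subset_Icc k).trans (Icc_subset_Icc ?_ ?_)
  · exact mul_nonneg (Nat.cast_nonneg _) (wk_pos k).le
  · have hlt : k < 2 ^ (Nat.log 2 k + 1) := Nat.lt_pow_succ_log_self one_lt_two k
    have hj : jOf k + 1 ≤ 2 ^ Nat.log 2 k := by
      unfold jOf
      have := Nat.pow_log_le_self 2 (Nat.one_le_iff_ne_zero.1 hk)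
      rw [pow_succ] at hlt
      omega
    have hj' : (jOf k : ℝ) + 1 ≤ 2 ^ Nat.log 2 k := by exact_mod_cast hj
    rw [wk, ← div_eq_mul_inv]
    exact (div_le_one (by positivity)).2 hj'

lemma volume_ΩS (k : ℕ) : volume (ΩS k) = ENNReal.ofReal (wk k) := by
  have h : ((jOf k : ℝ) + 1) * wk k - (jOf k : ℝ) * wk k = wk k := by ring
  unfold ΩS
  split_ifs
  · rw [Real.volume_Icc, h]
  · rw [Real.volume_Ico, h]

/-- The uniform distribution on `Ω_k`. -/
def unifk (k : ℕ) : Measure ↥ΩI :=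
  ENNReal.ofReal (wk k)⁻¹ • lebSub.restrict (Subtype.val ⁻¹' ΩS k)

lemma isProbabilityMeasure_unifk {k : ℕ} (hk : 1 ≤ k) : IsProbabilityMeasure (unifk k) := by
  constructor
  have hΩ : MeasurableSet ΩI := measurableSet_Icc
  rw [unifk, Measure.smul_apply, Measure.restrict_apply_univ, lebSub,
    comap_subtype_coe_apply hΩ, Subtype.image_preimage_coe,
    inter_eq_right.2 (ΩS_subset_ΩI hk), volume_ΩS, smul_eq_mul,
    ← ENNReal.ofReal_mul (inv_nonneg.2 (wk_pos k).le), inv_mul_cancel₀ (wk_pos k).ne',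
    ENNReal.ofReal_one]

lemma muk_of_mem {k : ℕ} {t : ℝ} (ht : t ∈ ΩS k) : muk k t = unifk k := if_pos ht

lemma muk_of_notMem {k : ℕ} {t : ℝ} (ht : t ∉ ΩS k) : muk k t = Measure.dirac z0 := if_neg ht

lemma isProbabilityMeasure_muk {k : ℕ} (hk : 1 ≤ k) (t : ℝ) :
    IsProbabilityMeasure (muk k t) := by
  by_cases ht : t ∈ ΩS k
  · rw [muk_of_mem ht]
    exact isProbabilityMeasure_unifk hk
  · rw [muk_of_notMem ht]
    infer_instance

lemma essVar_muk_le {k : ℕ} (hk : 1 ≤ k) : essVar W1M (muk k) ≤ 2 := by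
  have := isProbabilityMeasure_unifk hk
  exact (essVar_le_varOn _ _).trans <|
    varOn_le_two W1M (ordConnected_ΩS k) (fun t ht => muk_of_mem ht)
      (fun t ht => muk_of_notMem ht) (W1_self _) (W1_self _) (W1_le_one _ _) (W1_le_one _ _) _

lemma muk_mem_AdmR {k : ℕ} (hk : 1 ≤ k) : muk k ∈ AdmR := by
  have := isProbabilityMeasure_unifk hk
  refine ⟨1, fun t => ⟨muk k t, isProbabilityMeasure_muk hk t⟩, ?_, fun t => by simp⟩
  let a : ProbabilityMeasure ↥ΩI := ⟨unifk k, this⟩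
  let b : ProbabilityMeasure ↥ΩI := ⟨Measure.dirac z0, inferInstance⟩
  refine lt_of_le_of_lt ((essVar_le_varOn _ _).trans <|
    varOn_le_two W1P (ordConnected_ΩS k) (a := a) (b := b)
      (fun t ht => Subtype.ext (muk_of_mem ht)) (fun t ht => Subtype.ext (muk_of_notMem ht))
      (W1_self _) (W1_self _) (W1_le_one a b) (W1_le_one b a) _) (by norm_num)

lemma wtR_muk {k : ℕ} (hk : 1 ≤ k) : wtR (muk k) = 1 := by
  have := isProbabilityMeasure_muk hk 0
  simp [wtR]

lemma RegR_muk_le {k : ℕ} (hk : 1 ≤ k) : RegR (muk k) ≤ 3 := by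
  have h : (essVar W1M (muk k)).toReal ≤ 2 :=
    ENNReal.toReal_le_of_le_ofReal (by norm_num) (by simpa using essVar_muk_le hk)
  rw [RegR, wtR_muk hk]
  linarith

instance : CompactSpace ↥ΩI := isCompact_iff_compactSpace.1 isCompact_Icc

lemma abs_le_supNorm (φ : C(↥ΩI, ℝ)) (x : ↥ΩI) : |φ x| ≤ supNorm φ :=
  le_ciSup (f := fun x => |φ x|) (isCompact_range (by fun_prop)).bddAbove x

lemma supNorm_nonneg (φ : C(↥ΩI, ℝ)) : 0 ≤ supNorm φ :=
  (abs_nonneg _).trans (abs_le_supNorm φ z0)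

lemma abs_integral_le_supNorm (φ : C(↥ΩI, ℝ)) (ν : Measure ↥ΩI) [IsProbabilityMeasure ν] :
    |∫ x, φ x ∂ν| ≤ supNorm φ := by
  simpa using norm_integral_le_of_norm_le_const (μ := ν) (f := fun x => φ x)
    (ae_of_all _ (abs_le_supNorm φ))

/-- Weakly measurable families of continuous functions integrate to measurable functions. -/
lemma aemeasurable_integral_eval {φ : ℝ → C(↥ΩI, ℝ)} {lam : Measure ℝ}
    (hφ : ∀ x, AEMeasurable (fun t => φ t x) lam) (ν : Measure ↥ΩI) [IsFiniteMeasure ν] :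
    AEMeasurable (fun t => ∫ x, φ t x ∂ν) lam := by
  classical
  let s : ℕ → SimpleFunc ↥ΩI ↥ΩI :=
    SimpleFunc.approxOn id measurable_id univ z0 (mem_univ _)
  refine aemeasurable_of_tendsto_metrizable_ae' (f := fun n t => ∫ x, φ t (s n x) ∂ν)
    (fun n => ?_) (ae_of_all _ fun t => ?_)
  · have hsum : ∀ t, ∫ x, φ t (s n x) ∂ν =
        ∑ y ∈ (s n).range, ν.real (s n ⁻¹' {y}) * φ t y := by
      intro t
      have hpt : ∀ x, φ t (s n x) =
          ∑ y ∈ (s n).range, (s n ⁻¹' {y}).indicator (fun _ => φ t y) x := by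
        intro x
        rw [Finset.sum_eq_single (s n x)]
        · simp
        · intro y _ hy
          exact indicator_of_notMem (by simpa using hy.symm) _
        · exact fun h => (h (SimpleFunc.mem_range_self _ _)).elim
      simp_rw [hpt]
      rw [integral_finsetSum _ fun y _ =>
        (integrable_const _).indicator ((s n).measurableSet_fiber y)]
      refine Finset.sum_congr rfl fun y _ => ?_
      rw [integral_indicator_const _ ((s n).measurableSet_fiber y), smul_eq_mul]
    simp_rw [hsum]
    exact Finset.aemeasurable_fun_sum _ fun y _ => (hφ y).const_mul _
  · refine tendsto_integral_of_dominated_convergence (fun _ => supNorm (φ t))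
      (fun n => ?_) (integrable_const _) (fun n => ae_of_all _ fun x => abs_le_supNorm _ _)
      (ae_of_all _ fun x => ?_)
    · exact ((φ t).continuous.measurable.comp (s n).measurable).aestronglyMeasurable
    · exact ((φ t).continuous.tendsto x).comp
        (SimpleFunc.tendsto_approxOn measurable_id (mem_univ z0) (by simp))

lemma lintegral_supNorm_lt_top {φ : ℝ → C(↥ΩI, ℝ)} (hφ : L2wTest φ) :
    ∫⁻ t in unitI, ENNReal.ofReal (supNorm (φ t)) < ⊤ := by
  have hle : ∀ x : ℝ≥0∞, x ≤ 1 + x ^ 2 := by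
    intro x
    rcases le_total x 1 with h | h
    · exact h.trans le_self_add
    · calc x = x * 1 := (mul_one x).symm
        _ ≤ x * x := by gcongr
        _ = x ^ 2 := (sq x).symm
        _ ≤ 1 + x ^ 2 := le_add_self
  refine (lintegral_mono fun t => hle _).trans_lt ?_
  rw [lintegral_add_left measurable_const]
  refine ENNReal.add_lt_top.2 ⟨?_, hφ.2⟩
  simp [unitI]

lemma tendsto_wk : Tendsto (fun m => wk (m + 1)) atTop (𝓝 0) := by
  have hlog : Tendsto (fun m : ℕ => Nat.log 2 (m + 1)) atTop atTop :=
    tendsto_atTop.2 fun n => (eventually_ge_atTop (2 ^ n)).mono fun m hm =>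
      Nat.le_log_of_pow_le one_lt_two (hm.trans m.le_succ)
  simpa [wk, Function.comp_def] using
    (tendsto_pow_atTop_nhds_zero_of_lt_one (r := (2 : ℝ)⁻¹) (by norm_num) (by norm_num)).comp hlog

lemma integrable_eval {φ : ℝ → C(↥ΩI, ℝ)} (hφ : L2wTest φ) (ν : Measure ↥ΩI)
    [IsProbabilityMeasure ν] : Integrable (fun t => ∫ x, φ t x ∂ν) (volume.restrict unitI) := by
  refine ⟨(aemeasurable_integral_eval hφ.1 ν).aestronglyMeasurable,
    (lintegral_mono fun t => ?_).trans_lt (lintegral_supNorm_lt_top hφ)⟩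
  rw [Real.enorm_eq_ofReal_abs]
  exact ENNReal.ofReal_le_ofReal (abs_integral_le_supNorm _ _)

lemma integral_muk_eq {φ : ℝ → C(↥ΩI, ℝ)} (k : ℕ) :
    (fun t => ∫ x, φ t x ∂(muk k t)) = fun t => (∫ x, φ t x ∂(Measure.dirac z0)) +
      (ΩS k).indicator (fun t => (∫ x, φ t x ∂(unifk k)) - ∫ x, φ t x ∂(Measure.dirac z0)) t := by
  funext t
  by_cases ht : t ∈ ΩS k
  · rw [muk_of_mem ht, indicator_of_mem ht]
    ring
  · rw [muk_of_notMem ht, indicator_of_notMem ht, add_zero]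

lemma wStarL2Tendsto_muk :
    WStarL2Tendsto (fun m => muk (m + 1)) (fun _ => Measure.dirac z0) := by
  intro φ hφ
  have hvol : Tendsto ((volume.restrict unitI) ∘ fun m => ΩS (m + 1)) atTop (𝓝 0) := by
    refine tendsto_of_tendsto_of_tendsto_of_le_of_le tendsto_const_nhds
      (h := fun m => ENNReal.ofReal (wk (m + 1))) ?_ (fun _ => bot_le) fun m => ?_
    · simpa using ENNReal.tendsto_ofReal tendsto_wk
    · exact (Measure.restrict_apply_le _ _).trans (volume_ΩS _).le
  have hlim := ENNReal.Tendsto.const_mul (a := 2)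
    (tendsto_setLIntegral_zero (lintegral_supNorm_lt_top hφ).ne hvol) (Or.inr (by norm_num))
  rw [mul_zero] at hlim
  rw [tendsto_iff_edist_tendsto_0]
  refine tendsto_of_tendsto_of_tendsto_of_le_of_le tendsto_const_nhds hlim
    (fun _ => bot_le) fun m => ?_
  have := isProbabilityMeasure_unifk (Nat.succ_le_succ (Nat.zero_le m))
  have hdiff : Integrable
      (fun t => (∫ x, φ t x ∂(unifk (m + 1))) - ∫ x, φ t x ∂(Measure.dirac z0))
      (volume.restrict unitI) := (integrable_eval hφ _).sub (integrable_eval hφ _)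
  dsimp only
  rw [integral_muk_eq, integral_add (integrable_eval hφ _)
    (hdiff.indicator (measurableSet_ΩS _)), edist_eq_enorm_sub, add_sub_cancel_left,
    integral_indicator (measurableSet_ΩS _), ← lintegral_const_mul' _ _ (by norm_num)]
  refine (enorm_integral_le_lintegral_enorm _).trans (lintegral_mono fun t => ?_)
  rw [Real.enorm_eq_ofReal_abs, ← ENNReal.ofReal_ofNat 2, ← ENNReal.ofReal_mul (by norm_num)]
  refine ENNReal.ofReal_le_ofReal ((abs_sub _ _).trans ?_)
  linarith [abs_integral_le_supNorm (φ t) (unifk (m + 1)),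
    abs_integral_le_supNorm (φ t) (Measure.dirac z0)]

/-- The inclusion `[0,1] → ℝ` as a test function. -/
def coordI : C(↥ΩI, ℝ) := ⟨Subtype.val, continuous_subtype_val⟩

lemma sub_wk_le_integral_muk {k : ℕ} (hk : 1 ≤ k) {t : ℝ} (ht : t ∈ ΩS k) :
    t - wk k ≤ ∫ x, coordI x ∂(muk k t) := by
  have := isProbabilityMeasure_unifk hk
  rw [muk_of_mem ht]
  have hae : ∀ᵐ x ∂(unifk k), (jOf k : ℝ) * wk k ≤ coordI x := by
    refine Measure.ae_smul_measure ?_ _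
    filter_upwards [ae_restrict_mem (measurable_subtype_coe (measurableSet_ΩS k))] with x hx
    exact (ΩS_subset_Icc k hx).1
  have hint : Integrable (fun x => coordI x) (unifk k) :=
    Integrable.of_bound coordI.continuous.aestronglyMeasurable (supNorm coordI)
      (ae_of_all _ (abs_le_supNorm coordI))
  have hmono := integral_mono_ae (integrable_const _) hint hae
  rw [integral_const, probReal_univ, one_smul] at hmono
  linarith [(ΩS_subset_Icc k ht).2]

/-- Every time in `[0,1)` lies in one of the intervals of each dyadic generation. -/
lemma exists_mem_ΩS {t : ℝ} (ht : t ∈ Ico (0 : ℝ) 1) (n : ℕ) :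
    ∃ m : ℕ, n ≤ m + 1 ∧ t ∈ ΩS (m + 1) := by
  set j := ⌊t * 2 ^ n⌋₊ with hj
  have hpos : (0 : ℝ) < 2 ^ n := by positivity
  have h0 : 0 ≤ t * 2 ^ n := mul_nonneg ht.1 hpos.le
  have hjlt : j < 2 ^ n := by
    rw [hj, Nat.floor_lt h0]
    push_cast
    nlinarith [ht.2]
  have hn : n < 2 ^ n := Nat.lt_two_pow_self
  obtain ⟨m, hm⟩ : ∃ m, m + 1 = 2 ^ n + j := ⟨2 ^ n + j - 1, by omega⟩
  have hlog : Nat.log 2 (m + 1) = n := by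
    rw [hm]
    refine Nat.log_eq_of_pow_le_of_lt_pow (by omega) ?_
    rw [pow_succ]
    omega
  have hjOf : jOf (m + 1) = j := by
    rw [jOf, hlog, hm]
    omega
  refine ⟨m, by omega, Ico_subset_ΩS _ ?_⟩
  rw [hjOf, wk, hlog, ← div_eq_mul_inv, ← div_eq_mul_inv]
  exact ⟨(div_le_iff₀ hpos).2 (Nat.floor_le h0), (lt_div_iff₀ hpos).2 (Nat.lt_floor_add_one _)⟩

lemma not_tendsto_integral_muk {t : ℝ} (ht : t ∈ Ioo (0 : ℝ) 1) :
    ¬ Tendsto (fun m => ∫ x, coordI x ∂(muk (m + 1) t)) atTop (𝓝 (coordI z0)) := by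
  intro h
  have h0 : coordI z0 = 0 := rfl
  rw [h0] at h
  obtain ⟨N, hN⟩ := eventually_atTop.1
    ((h.eventually_lt_const (half_pos ht.1)).and (tendsto_wk.eventually_lt_const (half_pos ht.1)))
  obtain ⟨m, hm, hmem⟩ := exists_mem_ΩS (Ioo_subset_Ico_self ht) (N + 1)
  have h1 := hN m (by omega)
  linarith [sub_wk_le_integral_muk (Nat.succ_le_succ (Nat.zero_le m)) hmem, h1.1, h1.2]

/-- Weak-* convergence in `L²_w` does not imply a.e. weak-* convergence
within sublevel sets of the regularizer: (i) each `μ^k` (for `k ≥ 1`) is admissible with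
weight `1` and essential variation at most `2`, so `μ^k ∈ L₃⁻(𝓡_{1,1})`; (ii) `μ^k ⇀* μ ≡ δ₀`
in `L²_w(I;ℳ(Ω))`; (iii) nevertheless there is `ψ ∈ C(Ω)` such that `⟨ψ, μ^k_t⟩` does not
converge to `ψ(0)` for a.e. `t` along the full sequence. -/
theorem weakstar_L2w_not_ae_weakstar :
    (∀ k : ℕ, 1 ≤ k →
      muk k ∈ AdmR ∧ wtR (muk k) = 1 ∧ essVar W1M (muk k) ≤ 2 ∧ RegR (muk k) ≤ 3) ∧
    WStarL2Tendsto (fun m => muk (m + 1)) (fun _ => Measure.dirac z0) ∧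
    ∃ ψ : C(↥ΩI, ℝ),
      ¬ (∀ᵐ t ∂lebI, Tendsto (fun m => ∫ x, ψ x ∂(muk (m + 1) t)) atTop (𝓝 (ψ z0))) := by
  refine ⟨fun k hk => ⟨muk_mem_AdmR hk, wtR_muk hk, essVar_muk_le hk, RegR_muk_le hk⟩,
    wStarL2Tendsto_muk, coordI, fun h => ?_⟩
  have hIoo : ∀ᵐ t ∂(volume.restrict (Ioo (0 : ℝ) 1)), False := by
    filter_upwards [ae_restrict_of_ae_restrict_of_subset Ioo_subset_Icc_self h,
      ae_restrict_mem measurableSet_Ioo] with t ht htI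
    exact not_tendsto_integral_muk htI ht
  rw [ae_iff] at hIoo
  simp at hIoo

end
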